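/- Let (N,R) be an STP instance with N=(V,E,σ) and |R|≥2. Let M be a minimum spanning tree of the distance network D_N(R), and let cmax be the maximum edge cost occurring in M. Then for every edge {u,v}∈E with σ({u,v}) > cmax, there exists an SMT of (N,R) that does not contain {u,v}; in particular, removing {u,v} from N does not change csmt(N,R). -/

import Mathlib

open SimpleGraph

variable {V : Type*}

/-- The cost of a walk: the sum of the costs of its edges. -/
def walkCost {G : SimpleGraph V} (σ : Sym2 V → ℕ) {u v : V} (w : G.Walk u v) : ℕ :=
  (w.edges.map σ).sum

/-- The shortest-path distance `d_N(u,v)` in the network `(G, σ)`. -/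
noncomputable def netDist (G : SimpleGraph V) (σ : Sym2 V → ℕ) (u v : V) : ℕ :=
  sInf {c | ∃ w : G.Walk u v, walkCost σ w = c}

/-- Shortest-path distance as a function on unordered pairs. -/
noncomputable def sym2Dist (G : SimpleGraph V) (σ : Sym2 V → ℕ) (e : Sym2 V) : ℕ :=
  sInf {c | ∃ x y : V, e = s(x, y) ∧ ∃ w : G.Walk x y, walkCost σ w = c}

/-- The cost of a subgraph: the sum of the costs of its edges. -/
noncomputable def subCost [Fintype V] {G : SimpleGraph V} (σ : Sym2 V → ℕ)
    (H : G.Subgraph) : ℕ :=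
  ∑ e ∈ H.edgeSet.toFinite.toFinset, σ e

/-- A Steiner tree for terminals `R`: a subtree of `G` whose vertex set contains `R`. -/
def IsSteinerTree {G : SimpleGraph V} (R : Set V) (H : G.Subgraph) : Prop :=
  H.coe.IsTree ∧ R ⊆ H.verts

/-- The minimum cost of a Steiner tree for `(G, σ, R)`. -/
noncomputable def csmt [Fintype V] (G : SimpleGraph V) (σ : Sym2 V → ℕ) (R : Set V) : ℕ :=
  sInf {c | ∃ H : G.Subgraph, IsSteinerTree R H ∧ subCost σ H = c}

/-- A Steiner minimal tree (SMT). -/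
def IsSMT [Fintype V] (G : SimpleGraph V) (σ : Sym2 V → ℕ) (R : Set V)
    (H : G.Subgraph) : Prop :=
  IsSteinerTree R H ∧ subCost σ H = csmt G σ R

/-- The sub-SMT cost `l*(u, I) = csmt(N, I ∪ {u})`. -/
noncomputable def lstar [Fintype V] (G : SimpleGraph V) (σ : Sym2 V → ℕ)
    (u : V) (I : Set V) : ℕ :=
  csmt G σ (I ∪ {u})

/-- The cost of a minimum spanning tree of the complete network on `S`
with edge weights `w` (as a function on unordered pairs of `V`). -/
noncomputable def mstCost [Fintype V] (w : Sym2 V → ℕ) (S : Set V) : ℕ :=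
  sInf {c | ∃ T : SimpleGraph ↥S, T.IsTree ∧
    c = ∑ e ∈ T.edgeSet.toFinite.toFinset, w (e.map (Subtype.val : ↥S → V))}

-- Auxiliary fold computing the Steiner distance of a walk: the pair of
-- (the maximum cost among the already completed elementary segments,
-- the cost of the initial elementary segment), where the walk is split at
-- every visited terminal of `R`.
open Classical in
noncomputable def segMax {G : SimpleGraph V} (σ : Sym2 V → ℕ) (R : Set V) :
    {a b : V} → G.Walk a b → ℕ × ℕ
  | _, _, SimpleGraph.Walk.nil => (0, 0)
  | _, _, @SimpleGraph.Walk.cons _ _ a c _ _ w =>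
      let p := segMax σ R w
      if c ∈ R then (max p.1 p.2, σ s(a, c)) else (p.1, σ s(a, c) + p.2)

/-- The Steiner distance of a walk with respect to terminals `R`:
the maximum cost among its elementary subpaths (obtained by splitting the
walk at the intermediate terminals). -/
noncomputable def walkSD {G : SimpleGraph V} (σ : Sym2 V → ℕ) (R : Set V)
    {a b : V} (w : G.Walk a b) : ℕ :=
  max (segMax σ R w).1 (segMax σ R w).2

/-- The restricted bottleneck Steiner distance `s̄(u,v)`: the minimum Steiner
distance among all paths connecting `u` and `v` that avoid the edge `{u,v}`. -/
noncomputable def restrictedBottleneck (G : SimpleGraph V) (σ : Sym2 V → ℕ)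
    (R : Set V) (u v : V) : ℕ :=
  sInf {c | ∃ w : G.Walk u v, w.IsPath ∧ s(u, v) ∉ w.edges ∧ walkSD σ R w = c}

/-- The bottleneck Steiner distance as a function on unordered pairs. -/
noncomputable def sym2Bottleneck (G : SimpleGraph V) (σ : Sym2 V → ℕ) (R : Set V)
    (e : Sym2 V) : ℕ :=
  sInf {c | ∃ x y : V, e = s(x, y) ∧ ∃ w : G.Walk x y, w.IsPath ∧ walkSD σ R w = c}

/-- The cost of a walk dominates the total cost of its set of edges. -/
theorem sum_edges_toFinset_le_walkCost [DecidableEq V] {G : SimpleGraph V} (σ : Sym2 V → ℕ)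
    {a b : V} (w : G.Walk a b) : ∑ e ∈ w.edges.toFinset, σ e ≤ walkCost σ w := by
  unfold walkCost
  induction w.edges with
  | nil => simp
  | cons e l ih =>
    rw [List.toFinset_cons, List.map_cons, List.sum_cons]
    by_cases he : e ∈ l.toFinset
    · rw [Finset.insert_eq_of_mem he]
      exact ih.trans (Nat.le_add_left _ _)
    · rw [Finset.sum_insert he]
      exact Nat.add_le_add_left ih _

/-- In a connected graph `sym2Dist` is attained by a walk. -/
theorem exists_walkCost_eq_sym2Dist {G : SimpleGraph V} (hconn : G.Connected)
    (σ : Sym2 V → ℕ) (a b : V) : ∃ w : G.Walk a b, walkCost σ w = sym2Dist G σ s(a, b) := by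
  have hne : {c | ∃ x y : V, s(a, b) = s(x, y) ∧ ∃ w : G.Walk x y, walkCost σ w = c}.Nonempty :=
    let ⟨w⟩ := hconn.preconnected a b
    ⟨_, a, b, rfl, w, rfl⟩
  obtain ⟨x, y, hxy, w, hw⟩ := Nat.sInf_mem hne
  rcases Sym2.eq_iff.1 hxy with ⟨rfl, rfl⟩ | ⟨rfl, rfl⟩
  · exact ⟨w, hw⟩
  · exact ⟨w.reverse, by simpa [walkCost, sym2Dist] using hw⟩

/-- The total edge cost of a spanning graph. -/
noncomputable def graphCost [Fintype V] (σ : Sym2 V → ℕ) (F : SimpleGraph V) : ℕ :=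
  ∑ e ∈ F.edgeSet.toFinite.toFinset, σ e

theorem graphCost_spanningCoe [Fintype V] {G : SimpleGraph V} (σ : Sym2 V → ℕ)
    (H : G.Subgraph) : graphCost σ H.spanningCoe = subCost σ H :=
  rfl

/-- Removing an edge lowers the total cost by the cost of that edge. -/
theorem graphCost_deleteEdges_add [Fintype V] (σ : Sym2 V → ℕ) {F : SimpleGraph V}
    {e : Sym2 V} (he : e ∈ F.edgeSet) :
    graphCost σ (F.deleteEdges {e}) + σ e = graphCost σ F := by
  classical
  unfold graphCost
  rw [← Finset.sum_erase_add _ _ (show e ∈ F.edgeSet.toFinite.toFinset by simpa using he)]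
  congr 2
  ext f
  simp [and_comm]

/-- Adding the edges of a walk raises the total cost by at most the cost of the walk. -/
theorem graphCost_sup_fromEdgeSet_le [Fintype V] {G : SimpleGraph V} (σ : Sym2 V → ℕ)
    (F : SimpleGraph V) {a b : V} (w : G.Walk a b) :
    graphCost σ (F ⊔ fromEdgeSet {e | e ∈ w.edges}) ≤ graphCost σ F + walkCost σ w := by
  classical
  refine le_trans ?_ (Nat.add_le_add_left (sum_edges_toFinset_le_walkCost σ w) _)
  refine le_trans (Finset.sum_le_sum_of_subset ?_)
    (le_of_le_of_eq (Nat.le_add_right _ _) (Finset.sum_union_inter (f := σ)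
      (s₁ := F.edgeSet.toFinite.toFinset) (s₂ := w.edges.toFinset)))
  intro e he
  simp only [Set.Finite.mem_toFinset, edgeSet_sup, edgeSet_fromEdgeSet, Set.mem_union,
    Set.mem_sdiff, Set.mem_ofPred_eq] at he
  simp only [Finset.mem_union, Set.Finite.mem_toFinset, List.mem_toFinset]
  exact he.imp_right And.left

/-- If all terminals lie in one component of `F ≤ G`, then `F` contains the edges of a Steiner
tree. -/
theorem exists_isSteinerTree_subCost_le [Fintype V] {G F : SimpleGraph V} (σ : Sym2 V → ℕ)
    (hle : F ≤ G) {R : Set V} {r : V} (hR : ∀ x ∈ R, F.Reachable r x) :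
    ∃ H : G.Subgraph, IsSteinerTree R H ∧ subCost σ H ≤ graphCost σ F := by
  let c := F.connectedComponentMk r
  obtain ⟨T, hTF, hT⟩ := c.maximal_connected_induce_supp.1.exists_isTree_le
  let H : G.Subgraph :=
    { verts := c.supp
      Adj := fun a b => ∃ (ha : a ∈ c.supp) (hb : b ∈ c.supp), T.Adj ⟨a, ha⟩ ⟨b, hb⟩
      adj_sub := fun ⟨_, _, h⟩ => hle (hTF h)
      edge_vert := fun ⟨ha, _, _⟩ => ha
      symm := ⟨fun _ _ ⟨ha, hb, h⟩ => ⟨hb, ha, h.symm⟩⟩ }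
  have hcoe : H.coe = T := by
    ext ⟨a, ha⟩ ⟨b, hb⟩
    exact ⟨fun ⟨_, _, h⟩ => h, fun h => ⟨ha, hb, h⟩⟩
  refine ⟨H, ⟨hcoe ▸ hT, fun x hx => ?_⟩, ?_⟩
  · exact ConnectedComponent.sound (hR x hx).symm
  · rw [← graphCost_spanningCoe]
    refine Finset.sum_le_sum_of_subset ?_
    have hHF : H.spanningCoe ≤ F := fun a b ⟨_, _, h⟩ => hTF h
    exact Set.Finite.toFinset_subset_toFinset.2 (edgeSet_subset_edgeSet.2 hHF)

theorem csmt_le_graphCost [Fintype V] {G F : SimpleGraph V} (σ : Sym2 V → ℕ)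
    (hle : F ≤ G) {R : Set V} {r : V} (hR : ∀ x ∈ R, F.Reachable r x) :
    csmt G σ R ≤ graphCost σ F :=
  let ⟨_, hH, hc⟩ := exists_isSteinerTree_subCost_le σ hle hR
  (Nat.sInf_le ⟨_, hH, rfl⟩ : csmt G σ R ≤ _).trans hc

/-- A Steiner minimal tree exists as soon as all terminals lie in one component. -/
theorem exists_isSMT [Fintype V] {G : SimpleGraph V} (σ : Sym2 V → ℕ) {R : Set V} {r : V}
    (hR : ∀ x ∈ R, G.Reachable r x) : ∃ H : G.Subgraph, IsSMT G σ R H := by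
  obtain ⟨H, hH, -⟩ := exists_isSteinerTree_subCost_le σ le_rfl hR
  have hne : {c | ∃ H : G.Subgraph, IsSteinerTree R H ∧ subCost σ H = c}.Nonempty :=
    ⟨_, H, hH, rfl⟩
  exact Nat.sInf_mem hne

theorem IsSteinerTree.reachable_spanningCoe {G : SimpleGraph V} {R : Set V} {H : G.Subgraph}
    (hH : IsSteinerTree R H) {a b : V} (ha : a ∈ H.verts) (hb : b ∈ H.verts) :
    H.spanningCoe.Reachable a b :=
  (hH.1.connected.preconnected ⟨a, ha⟩ ⟨b, hb⟩).map
    (⟨Subtype.val, fun h => h⟩ : H.coe →g H.spanningCoe)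

/-- After deleting the edge `{u, v}`, every vertex of the component of `u` is still connected to
`u` or to `v`. -/
theorem SimpleGraph.Reachable.deleteEdges_or {F : SimpleGraph V} {u v x : V}
    (h : F.Reachable u x) :
    (F.deleteEdges {s(u, v)}).Reachable u x ∨ (F.deleteEdges {s(u, v)}).Reachable v x := by
  obtain ⟨p⟩ := h.symm
  suffices ∀ {a b : V} (p : F.Walk a b), b = u →
      (F.deleteEdges {s(u, v)}).Reachable u a ∨ (F.deleteEdges {s(u, v)}).Reachable v a from
    this p rfl
  intro a b p
  induction p with
  | nil => rintro rfl; exact .inl .rfl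
  | @cons a c b hac p ih =>
    intro hb
    by_cases he : s(a, c) = s(u, v)
    · rcases Sym2.eq_iff.1 he with ⟨rfl, -⟩ | ⟨rfl, -⟩
      · exact .inl .rfl
      · exact .inr .rfl
    · have hca : (F.deleteEdges {s(u, v)}).Reachable c a :=
        (Adj.reachable (by simpa [deleteEdges_adj, hac] using he)).symm
      exact (ih hb).imp (·.trans hca) (·.trans hca)

/-- If the terminals are connected by a tree `T` all of whose edges are shorter in the distance
network than `σ {u, v}`, then no Steiner minimal tree uses the edge `{u, v}`. -/
theorem IsSMT.notMem_edgeSet [Fintype V] {G : SimpleGraph V} {σ : Sym2 V → ℕ}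
    (hconn : G.Connected) {R : Set V} {T : SimpleGraph ↥R} (hT : T.Connected) {u v : V}
    (hlt : ∀ x y : ↥R, T.Adj x y → sym2Dist G σ s(x.1, y.1) < σ s(u, v))
    (hpos : 0 < σ s(u, v)) {H : G.Subgraph} (hH : IsSMT G σ R H) : s(u, v) ∉ H.edgeSet := by
  intro he
  set F := H.spanningCoe.deleteEdges {s(u, v)} with hF
  have hFG : F ≤ G := (deleteEdges_le _).trans H.spanningCoe_le
  have hcost : graphCost σ F + σ s(u, v) = csmt G σ R := by
    rw [hF, graphCost_deleteEdges_add σ (by simpa using he), graphCost_spanningCoe, hH.2]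
  have hsplit : ∀ x ∈ R, F.Reachable u x ∨ F.Reachable v x := fun x hx =>
    (hH.1.reachable_spanningCoe (H.edge_vert he) (hH.1.2 hx)).deleteEdges_or
  by_cases hu : ∀ x ∈ R, F.Reachable u x
  · have := csmt_le_graphCost σ hFG hu
    omega
  by_cases hv : ∀ x ∈ R, F.Reachable v x
  · have := csmt_le_graphCost σ hFG hv
    omega
  push Not at hu hv
  obtain ⟨y, hy, hyu⟩ := hu
  obtain ⟨x, hx, hxv⟩ := hv
  obtain ⟨p⟩ := hT.preconnected ⟨x, hx⟩ ⟨y, hy⟩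
  obtain ⟨d, -, hd₁, hd₂⟩ := p.exists_boundary_dart {z | F.Reachable u z.1}
    ((hsplit x hx).resolve_right hxv) hyu
  obtain ⟨w, hw⟩ := exists_walkCost_eq_sym2Dist hconn σ d.fst.1 d.snd.1
  have hwlt := hlt _ _ d.adj
  set K := F ⊔ fromEdgeSet {e | e ∈ w.edges}
  have hKG : K ≤ G := sup_le hFG fun a b h => w.edges_subset_edgeSet h.1
  have hwK : K.Reachable d.fst.1 d.snd.1 :=
    ⟨w.transfer K fun e he => by
      rw [edgeSet_sup, edgeSet_fromEdgeSet]
      exact .inr ⟨he, G.not_isDiag_of_mem_edgeSet (w.edges_subset_edgeSet he)⟩⟩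
  have huv : K.Reachable u v :=
    ((hd₁.mono le_sup_left).trans hwK).trans
      (((hsplit _ d.snd.2).resolve_left hd₂).mono le_sup_left).symm
  have hK : ∀ z ∈ R, K.Reachable u z := fun z hz =>
    (hsplit z hz).elim (·.mono le_sup_left) fun h => huv.trans (h.mono le_sup_left)
  have h₁ := csmt_le_graphCost σ hKG hK
  have h₂ : graphCost σ K ≤ _ := graphCost_sup_fromEdgeSet_le σ F w
  omega

/-- Deleting an edge avoided by some Steiner minimal tree preserves the minimum cost. -/
theorem csmt_deleteEdges_of_isSMT [Fintype V] {G : SimpleGraph V} {σ : Sym2 V → ℕ} {R : Set V}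
    (hR : R.Nonempty) {e : Sym2 V} {H : G.Subgraph} (hH : IsSMT G σ R H)
    (he : e ∉ H.edgeSet) : csmt (G.deleteEdges {e}) σ R = csmt G σ R := by
  obtain ⟨r, hr⟩ := hR
  have hle : H.spanningCoe ≤ G.deleteEdges {e} := fun a b h => by
    refine deleteEdges_adj.2 ⟨H.adj_sub h, ?_⟩
    rintro rfl
    exact he h
  have hreach : ∀ x ∈ R, H.spanningCoe.Reachable r x := fun x hx =>
    hH.1.reachable_spanningCoe (hH.1.2 hr) (hH.1.2 hx)
  apply le_antisymm
  · rw [← hH.2, ← graphCost_spanningCoe]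
    exact csmt_le_graphCost σ hle hreach
  · obtain ⟨H', hH'⟩ := exists_isSMT σ fun x hx => (hreach x hx).mono hle
    rw [← hH'.2, ← graphCost_spanningCoe]
    exact csmt_le_graphCost σ (H'.spanningCoe_le.trans (deleteEdges_le _)) fun x hx =>
      hH'.1.reachable_spanningCoe (hH'.1.2 hr) (hH'.1.2 hx)

/-- Any edge more costly than the largest edge of a minimum
spanning tree of the distance network on the terminals can be avoided by some
SMT, and removing it does not change the Steiner minimal tree cost. -/
theorem remove_long_edges
    [Fintype V] (G : SimpleGraph V) (σ : Sym2 V → ℕ)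
    (hconn : G.Connected) (hpos : ∀ e ∈ G.edgeSet, 0 < σ e)
    (R : Set V) (hR : 2 ≤ R.ncard)
    (T : SimpleGraph ↥R) (hTtree : T.IsTree)
    (hTmin : (∑ e ∈ T.edgeSet.toFinite.toFinset,
        sym2Dist G σ (e.map (Subtype.val : ↥R → V))) = mstCost (sym2Dist G σ) R)
    (cmax : ℕ)
    (hcmax : cmax = T.edgeSet.toFinite.toFinset.sup
        (fun e => sym2Dist G σ (e.map (Subtype.val : ↥R → V))))
    (u v : V) (hadj : G.Adj u v) (hgt : cmax < σ s(u, v)) :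
    (∃ H : G.Subgraph, IsSMT G σ R H ∧ s(u, v) ∉ H.edgeSet) ∧
    csmt (G.deleteEdges {s(u, v)}) σ R = csmt G σ R := by
  have hRne : R.Nonempty := Set.nonempty_of_ncard_ne_zero (by omega)
  obtain ⟨H, hH⟩ := exists_isSMT σ fun x (_ : x ∈ R) => hconn.preconnected hRne.some x
  have hlt : ∀ x y : ↥R, T.Adj x y → sym2Dist G σ s(x.1, y.1) < σ s(u, v) := by
    intro x y hxy
    refine lt_of_le_of_lt ?_ hgt
    rw [hcmax]
    exact Finset.le_sup (f := fun e => sym2Dist G σ (e.map (Subtype.val : ↥R → V)))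
      (show s(x, y) ∈ T.edgeSet.toFinite.toFinset by simpa using hxy)
  have he := hH.notMem_edgeSet hconn hTtree.connected hlt (by omega)
  exact ⟨⟨H, hH, he⟩, csmt_deleteEdges_of_isSMT hRne hH he⟩
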